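/- Let H be a real Hilbert space, let η > 0, ε ≥ 0, Z ≥ 0, D ≥ 0, and let T ≥ 1 be an integer. For each t = 1,…,T let L_t : H → ℝ be convex and differentiable with gradient ∇L_t, let f★ ∈ H, and let f_1,…,f_{T+1} ∈ H satisfy the inexact gradient step ‖f_{t+1} − (f_t − η ∇L_t(f_t))‖ ≤ ε for all t = 1,…,T. Assume ‖∇L_t(f_t)‖ ≤ Z and ‖f_t − f★‖ ≤ D for all t = 1,…,T. Then the static regret satisfies Σ_{t=1}^T (L_t(f_t) − L_t(f★)) ≤ ‖f_1 − f★‖²/(2η) + εTD/η + ε²T/η + η Z² T. -/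

import Mathlib

theorem aux_first_order {H : Type*} [NormedAddCommGroup H] [InnerProductSpace ℝ H]
    [CompleteSpace H] (F : H → ℝ) (g x y : H) (hc : ConvexOn ℝ Set.univ F)
    (hg : HasGradientAt F g x) : F x - F y ≤ inner ℝ (x - y) g := by
  have hc' : ConvexOn ℝ Set.univ (F ∘ (AffineMap.lineMap x y : ℝ →ᵃ[ℝ] H)) := by
    simpa using hc.comp_affineMap (AffineMap.lineMap x y : ℝ →ᵃ[ℝ] H)
  have hl : HasDerivAt (fun s : ℝ => (AffineMap.lineMap x y : ℝ →ᵃ[ℝ] H) s) (y - x) 0 :=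
    AffineMap.hasDerivAt_lineMap
  have hF : HasFDerivAt F (InnerProductSpace.toDual ℝ H g)
      ((AffineMap.lineMap x y : ℝ →ᵃ[ℝ] H) 0) := by
    simpa using hg.hasFDerivAt
  have hd := hF.comp_hasDerivAt (0 : ℝ) hl
  have h := hc'.le_slope_of_hasDerivAt (Set.mem_univ 0) (Set.mem_univ 1) one_pos hd
  simp [slope_def_field] at h
  have e : inner ℝ g (y - x) = - inner ℝ (x - y) g := by
    rw [real_inner_comm, ← inner_neg_left, neg_sub]
  linarith

theorem aux_step {H : Type*} [NormedAddCommGroup H] [InnerProductSpace ℝ H]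
    (η ε Z D : ℝ) (hη : 0 < η) (hD : 0 ≤ D) (u g v : H)
    (hs : ‖v - (u - η • g)‖ ≤ ε) (hg : ‖g‖ ≤ Z) (hu : ‖u‖ ≤ D) :
    inner ℝ u g + ‖v‖ ^ 2 / (2 * η) ≤
      ‖u‖ ^ 2 / (2 * η) + ε * D / η + ε ^ 2 / η + η * Z ^ 2 := by
  obtain ⟨e, rfl⟩ : ∃ e, v = u - (η • g - e) := ⟨v - (u - η • g), by abel⟩
  have he : ‖e‖ ≤ ε := by
    have : u - (η • g - e) - (u - η • g) = e := by abel
    rwa [this] at hs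
  have h1 := norm_sub_sq_real u (η • g - e)
  have h2 : ‖η • g - e‖ ≤ η * Z + ε := by
    refine (norm_sub_le _ _).trans (add_le_add ?_ he)
    rw [norm_smul, Real.norm_of_nonneg hη.le]
    gcongr
  have h3 : ‖η • g - e‖ ^ 2 ≤ (η * Z + ε) ^ 2 := by gcongr
  have h4 : inner ℝ u e ≤ D * ε := (real_inner_le_norm u e).trans (by gcongr)
  rw [inner_sub_right, inner_smul_right] at h1
  have h5 : 2 * η * inner ℝ u g + ‖u - (η • g - e)‖ ^ 2 ≤
      ‖u‖ ^ 2 + 2 * ε * D + 2 * ε ^ 2 + 2 * η ^ 2 * Z ^ 2 := by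
    nlinarith [sq_nonneg (η * Z - ε)]
  have e1 : inner ℝ u g + ‖u - (η • g - e)‖ ^ 2 / (2 * η) =
      (2 * η * inner ℝ u g + ‖u - (η • g - e)‖ ^ 2) / (2 * η) := by field_simp
  have e2 : ‖u‖ ^ 2 / (2 * η) + ε * D / η + ε ^ 2 / η + η * Z ^ 2 =
      (‖u‖ ^ 2 + 2 * ε * D + 2 * ε ^ 2 + 2 * η ^ 2 * Z ^ 2) / (2 * η) := by field_simp
  rw [e1, e2]
  gcongr

/-- Static regret theorem: inexact gradient steps with bounded gradients and bounded iterate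
distances achieve the stated static regret bound. -/
theorem stmt_4 {H : Type*} [NormedAddCommGroup H] [InnerProductSpace ℝ H] [CompleteSpace H]
    (η ε Z D : ℝ) (hη : 0 < η) (hε : 0 ≤ ε) (hZ : 0 ≤ Z) (hD : 0 ≤ D)
    (T : ℕ) (hT : 1 ≤ T)
    (L : ℕ → H → ℝ) (L' : ℕ → H → H)
    (hconv : ∀ t ∈ Finset.Icc 1 T, ConvexOn ℝ Set.univ (L t))
    (hgrad : ∀ t ∈ Finset.Icc 1 T, ∀ x : H, HasGradientAt (L t) (L' t x) x)
    (fstar : H) (f : ℕ → H)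
    (hstep : ∀ t ∈ Finset.Icc 1 T, ‖f (t + 1) - (f t - η • L' t (f t))‖ ≤ ε)
    (hgradbd : ∀ t ∈ Finset.Icc 1 T, ‖L' t (f t)‖ ≤ Z)
    (hdist : ∀ t ∈ Finset.Icc 1 T, ‖f t - fstar‖ ≤ D) :
    ∑ t ∈ Finset.Icc 1 T, (L t (f t) - L t fstar) ≤
      ‖f 1 - fstar‖ ^ 2 / (2 * η) + ε * T * D / η + ε ^ 2 * T / η + η * Z ^ 2 * T := by
  have key : ∀ n : ℕ, n ≤ T →
      ∑ t ∈ Finset.Icc 1 n, (L t (f t) - L t fstar) + ‖f (n + 1) - fstar‖ ^ 2 / (2 * η) ≤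
      ‖f 1 - fstar‖ ^ 2 / (2 * η) + n * (ε * D / η + ε ^ 2 / η + η * Z ^ 2) := by
    intro n
    induction n with
    | zero => intro _; simp
    | succ n ih =>
      intro hn
      have ih' := ih (by omega)
      have hm : n + 1 ∈ Finset.Icc 1 T := Finset.mem_Icc.2 ⟨by omega, hn⟩
      rw [Finset.sum_Icc_succ_top (by omega)]
      have a1 := aux_first_order (L (n + 1)) _ (f (n + 1)) fstar (hconv _ hm) (hgrad _ hm _)
      have a2 := aux_step η ε Z D hη hD (f (n + 1) - fstar) (L' (n + 1) (f (n + 1)))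
        (f (n + 1 + 1) - fstar) (by
          have := hstep _ hm
          convert this using 2
          abel) (hgradbd _ hm) (hdist _ hm)
      push_cast
      linarith
  have h := key T le_rfl
  have hp : 0 ≤ ‖f (T + 1) - fstar‖ ^ 2 / (2 * η) := by positivity
  have e : (T : ℝ) * (ε * D / η + ε ^ 2 / η + η * Z ^ 2) =
      ε * T * D / η + ε ^ 2 * T / η + η * Z ^ 2 * T := by ring
  linarith
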